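/- For each p > 1, the class M^p equipped with the topology induced by the metric ρ_p is an F-algebra: (M^p, ρ_p) is a complete metrizable topological vector space over ℂ in which pointwise multiplication is jointly continuous. -/

import Mathlib

open MeasureTheory Filter Set
open scoped ENNReal Topology Real NNReal

noncomputable section

/-- The open unit disk in the complex plane. -/
def unitDisk : Set ℂ := Metric.ball 0 1

/-- The point `r·e^{iθ}`. -/
def circlePt (r θ : ℝ) : ℂ := (r : ℂ) * Complex.exp (θ * Complex.I)

/-- The maximal radial function `Mf(θ) = sup_{0 ≤ r < 1} |f(r e^{iθ})|`, valued in `ℝ≥0∞`. -/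
def maxRad (f : ℂ → ℂ) (θ : ℝ) : ℝ≥0∞ :=
  ⨆ r ∈ Set.Ico (0 : ℝ) 1, (‖f (circlePt r θ)‖₊ : ℝ≥0∞)

/-- `log⁺` on `ℝ≥0∞`. -/
def elogPlus (x : ℝ≥0∞) : ℝ≥0∞ :=
  if x = ∞ then ∞ else ENNReal.ofReal (Real.log x.toReal)

/-- `x ↦ log (1 + x)` on `ℝ≥0∞`. -/
def elog1p (x : ℝ≥0∞) : ℝ≥0∞ :=
  if x = ∞ then ∞ else ENNReal.ofReal (Real.log (1 + x.toReal))

/-- The radial boundary value `f*(e^{iθ}) = lim_{r→1⁻} f(r e^{iθ})`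
(a junk value is returned where the limit does not exist). -/
def radialLimit (f : ℂ → ℂ) (θ : ℝ) : ℂ :=
  limUnder (nhdsWithin (1 : ℝ) (Set.Iio 1)) fun r : ℝ => f (circlePt r θ)

/-- The class `M^p`: holomorphic functions on the unit disk with
`∫₀^{2π} (log⁺ Mf(θ))^p dθ/2π < ∞`. -/
def MpClass (p : ℝ) : Set (ℂ → ℂ) :=
  {f | DifferentiableOn ℂ f unitDisk ∧
    (∫⁻ θ in Set.Ioc 0 (2 * π), elogPlus (maxRad f θ) ^ p) / ENNReal.ofReal (2 * π) < ∞}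

/-- The metric `ρ_p` on `M^p`. -/
def rhoMetric (p : ℝ) (f g : ℂ → ℂ) : ℝ≥0∞ :=
  ((∫⁻ θ in Set.Ioc 0 (2 * π), elog1p (maxRad (f - g) θ) ^ p) /
    ENNReal.ofReal (2 * π)) ^ (1 / p)

/-- The Privalov class `N^p`: holomorphic functions on the unit disk with
`sup_{0≤r<1} ∫₀^{2π} (log⁺|f(re^{iθ})|)^p dθ/2π < ∞`. -/
def NpClass (p : ℝ) : Set (ℂ → ℂ) :=
  {f | DifferentiableOn ℂ f unitDisk ∧
    (⨆ r ∈ Set.Ico (0 : ℝ) 1,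
      (∫⁻ θ in Set.Ioc 0 (2 * π),
        ENNReal.ofReal (Real.log ‖f (circlePt r θ)‖) ^ p) / ENNReal.ofReal (2 * π)) < ∞}

/-- The metric `d_p` on `N^p`, defined via boundary values. -/
def dMetric (p : ℝ) (f g : ℂ → ℂ) : ℝ≥0∞ :=
  ((∫⁻ θ in Set.Ioc 0 (2 * π),
      ENNReal.ofReal (Real.log (1 + ‖radialLimit f θ - radialLimit g θ‖)) ^ p) /
    ENNReal.ofReal (2 * π)) ^ (1 / p)

/-- The Hardy space `H^p`. -/
def HpClass (p : ℝ) : Set (ℂ → ℂ) :=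
  {f | DifferentiableOn ℂ f unitDisk ∧
    (⨆ r ∈ Set.Ico (0 : ℝ) 1,
      (∫⁻ θ in Set.Ioc 0 (2 * π), (‖f (circlePt r θ)‖₊ : ℝ≥0∞) ^ p) /
        ENNReal.ofReal (2 * π)) < ∞}

/-- The Smirnov class `N⁺`. -/
def SmirnovClass : Set (ℂ → ℂ) :=
  {f | DifferentiableOn ℂ f unitDisk ∧
    (∫⁻ θ in Set.Ioc 0 (2 * π), ENNReal.ofReal (Real.log ‖radialLimit f θ‖)) /
      ENNReal.ofReal (2 * π) < ∞ ∧
    Tendsto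
      (fun r : ℝ => (∫⁻ θ in Set.Ioc 0 (2 * π),
        ENNReal.ofReal (Real.log ‖f (circlePt r θ)‖)) / ENNReal.ofReal (2 * π))
      (nhdsWithin (1 : ℝ) (Set.Iio 1))
      (nhds ((∫⁻ θ in Set.Ioc 0 (2 * π),
        ENNReal.ofReal (Real.log ‖radialLimit f θ‖)) / ENNReal.ofReal (2 * π)))}

/-- The normalized Blaschke factor `(|a|/a)·(a − z)/(1 − conj a · z)`. -/
def blaschkeFactor (a z : ℂ) : ℂ :=
  ((‖a‖ : ℂ) / a) * ((a - z) / (1 - (starRingEnd ℂ) a * z))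

/-- `B` is a (finite or infinite) Blaschke product on the unit disk. -/
def IsBlaschkeProduct (B : ℂ → ℂ) : Prop :=
  ∃ m : ℕ,
    (∃ n : ℕ, ∃ a : ℕ → ℂ, (∀ k < n, a k ∈ unitDisk ∧ a k ≠ 0) ∧
      ∀ z ∈ unitDisk, B z = z ^ m * ∏ k ∈ Finset.range n, blaschkeFactor (a k) z) ∨
    (∃ a : ℕ → ℂ, (∀ k, a k ∈ unitDisk ∧ a k ≠ 0) ∧ (Summable fun k => 1 - ‖a k‖) ∧
      ∀ z ∈ unitDisk, B z = z ^ m * ∏' k, blaschkeFactor (a k) z)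

/-- `I` is an ideal of the ring `M^p`. -/
structure IsIdealIn (p : ℝ) (I : Set (ℂ → ℂ)) : Prop where
  subset : I ⊆ MpClass p
  zero_mem : (0 : ℂ → ℂ) ∈ I
  add_mem : ∀ f ∈ I, ∀ g ∈ I, f + g ∈ I
  neg_mem : ∀ f ∈ I, -f ∈ I
  mul_mem : ∀ f ∈ MpClass p, ∀ g ∈ I, f * g ∈ I

/-- `I` is a prime ideal of the ring `M^p`: an ideal such that whenever a product of two
elements of `M^p` lies in `I`, one of the factors lies in `I`. -/
def IsPrimeIdealIn (p : ℝ) (I : Set (ℂ → ℂ)) : Prop :=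
  IsIdealIn p I ∧ ∀ f ∈ MpClass p, ∀ g ∈ MpClass p, f * g ∈ I → f ∈ I ∨ g ∈ I

/-- `I` is a dense subset of the metric space `(M^p, ρ_p)`. -/
def IsDenseIn (p : ℝ) (I : Set (ℂ → ℂ)) : Prop :=
  ∀ f ∈ MpClass p, ∀ ε : ℝ≥0∞, 0 < ε → ∃ g ∈ I, rhoMetric p f g < ε

/-- `I` is an ideal of the ring `N^p`. -/
structure IsIdealInNp (p : ℝ) (I : Set (ℂ → ℂ)) : Prop where
  subset : I ⊆ NpClass p
  zero_mem : (0 : ℂ → ℂ) ∈ I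
  add_mem : ∀ f ∈ I, ∀ g ∈ I, f + g ∈ I
  neg_mem : ∀ f ∈ I, -f ∈ I
  mul_mem : ∀ f ∈ NpClass p, ∀ g ∈ I, f * g ∈ I

/-- `I` is a prime ideal of the ring `N^p`. -/
def IsPrimeIdealInNp (p : ℝ) (I : Set (ℂ → ℂ)) : Prop :=
  IsIdealInNp p I ∧ ∀ f ∈ NpClass p, ∀ g ∈ NpClass p, f * g ∈ I → f ∈ I ∨ g ∈ I

/-- `I` is a dense subset of the metric space `(N^p, d_p)`. -/
def IsDenseInNp (p : ℝ) (I : Set (ℂ → ℂ)) : Prop :=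
  ∀ f ∈ NpClass p, ∀ ε : ℝ≥0∞, 0 < ε → ∃ g ∈ I, dMetric p f g < ε



/-! ### Properties of `elog1p` -/

lemma elog1p_eq (x : ℝ≥0∞) : elog1p x = (ENNReal.log (1 + x)).toENNReal := by
  unfold elog1p
  split_ifs with h
  · subst h; simp
  · rw [ENNReal.log_pos_real (by simp) (by simp [h]), ENNReal.toReal_add (by simp) h]
    simp

lemma elog1p_mono : Monotone elog1p := by
  intro x y h
  rw [elog1p_eq, elog1p_eq]
  exact EReal.toENNReal_le_toENNReal (ENNReal.log_monotone (by gcongr))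

lemma elog1p_continuous : Continuous elog1p := by
  have : elog1p = fun x => (ENNReal.log (1 + x)).toENNReal := funext elog1p_eq
  rw [this]
  exact EReal.continuous_toENNReal.comp (ENNReal.continuous_log.comp (by fun_prop))

lemma elog1p_ofReal (x : ℝ) (hx : 0 ≤ x) :
    elog1p (ENNReal.ofReal x) = ENNReal.ofReal (Real.log (1 + x)) := by
  simp [elog1p, hx]

@[simp] lemma elog1p_zero : elog1p 0 = 0 := by simp [elog1p]

@[simp] lemma elog1p_top : elog1p ∞ = ∞ := by simp [elog1p]

lemma elog1p_eq_zero {x : ℝ≥0∞} (h : elog1p x = 0) : x = 0 := by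
  by_contra hx
  have htop : x ≠ ∞ := by rintro rfl; simp at h
  have hpos := ENNReal.toReal_pos hx htop
  simp only [elog1p, htop, if_false, ENNReal.ofReal_eq_zero] at h
  have := Real.log_pos (x := 1 + x.toReal) (by linarith)
  linarith

lemma elog1p_pos {x : ℝ≥0∞} (h : 0 < x) : 0 < elog1p x :=
  pos_iff_ne_zero.2 fun h' => h.ne' (elog1p_eq_zero h')

lemma elog1p_add (x y : ℝ≥0∞) : elog1p (x + y) ≤ elog1p x + elog1p y := by
  rcases eq_or_ne x ∞ with rfl | hx
  · simp
  rcases eq_or_ne y ∞ with rfl | hy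
  · simp
  lift x to ℝ≥0 using hx
  lift y to ℝ≥0 using hy
  have hx := x.2
  have hy := y.2
  have hxy : (x : ℝ≥0∞) + y ≠ ∞ := by simp
  simp only [elog1p, hxy, ENNReal.coe_ne_top, if_false]
  rw [← ENNReal.ofReal_add (Real.log_nonneg (by simp)) (Real.log_nonneg (by simp)),
    ← Real.log_mul (by positivity) (by positivity)]
  apply ENNReal.ofReal_le_ofReal
  apply Real.log_le_log (by positivity)
  rw [ENNReal.toReal_add (by simp) (by simp)]
  simp only [ENNReal.coe_toReal]
  nlinarith [mul_nonneg x.2 y.2]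

lemma elog1p_mul (x y : ℝ≥0∞) : elog1p (x * y) ≤ elog1p x + elog1p y := by
  rcases eq_or_ne x ∞ with rfl | hx
  · simp
  rcases eq_or_ne y ∞ with rfl | hy
  · simp
  lift x to ℝ≥0 using hx
  lift y to ℝ≥0 using hy
  have hxy : (x : ℝ≥0∞) * y ≠ ∞ := ENNReal.mul_ne_top (by simp) (by simp)
  simp only [elog1p, hxy, ENNReal.coe_ne_top, if_false]
  rw [← ENNReal.ofReal_add (Real.log_nonneg (by simp)) (Real.log_nonneg (by simp)),
    ← Real.log_mul (by positivity) (by positivity)]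
  apply ENNReal.ofReal_le_ofReal
  apply Real.log_le_log (by positivity)
  rw [ENNReal.toReal_mul]
  simp only [ENNReal.coe_toReal]
  nlinarith [x.2, y.2]

lemma elog1p_nat_mul (K : ℕ) (y : ℝ≥0∞) : elog1p (K * y) ≤ K * elog1p y := by
  rcases Nat.eq_zero_or_pos K with rfl | hK
  · simp
  rcases eq_or_ne y ∞ with rfl | hy
  · simp [ENNReal.mul_top, hK.ne']
  lift y to ℝ≥0 using hy
  have hxy : (K : ℝ≥0∞) * y ≠ ∞ := ENNReal.mul_ne_top (by simp) (by simp)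
  simp only [elog1p, hxy, ENNReal.coe_ne_top, if_false]
  rw [← ENNReal.ofReal_natCast, ← ENNReal.ofReal_mul (by positivity), ← Real.log_pow]
  apply ENNReal.ofReal_le_ofReal
  apply Real.log_le_log (by positivity)
  rw [ENNReal.toReal_mul]
  simp only [ENNReal.coe_toReal, ENNReal.toReal_ofReal (Nat.cast_nonneg K)]
  exact one_add_mul_le_pow (by have : (0:ℝ) ≤ y := y.2; linarith) K

lemma elogPlus_le (x : ℝ≥0∞) : elogPlus x ≤ elog1p x := by
  unfold elogPlus elog1p
  split_ifs with h
  · rfl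
  · apply ENNReal.ofReal_le_ofReal
    rcases eq_or_lt_of_le (ENNReal.toReal_nonneg (a := x)) with h0 | h0
    · simp [← h0]
    · exact Real.log_le_log h0 (by linarith)

lemma elog1p_le_elogPlus (x : ℝ≥0∞) : elog1p x ≤ ENNReal.ofReal (Real.log 2) + elogPlus x := by
  unfold elogPlus elog1p
  split_ifs with h
  · simp
  · rcases le_or_gt x.toReal 1 with h1 | h1
    · refine le_trans (ENNReal.ofReal_le_ofReal ?_) le_self_add
      have := ENNReal.toReal_nonneg (a := x)
      exact Real.log_le_log (by linarith) (by linarith)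
    · rw [← ENNReal.ofReal_add (Real.log_nonneg (by norm_num)) (Real.log_nonneg h1.le),
        ← Real.log_mul (by norm_num) (by linarith)]
      exact ENNReal.ofReal_le_ofReal (Real.log_le_log (by linarith) (by linarith))

lemma elogPlus_measurable : Measurable elogPlus := by
  unfold elogPlus
  refine Measurable.ite (measurableSet_singleton _) measurable_const ?_
  fun_prop

/-- Key splitting inequality for multiplication by a fixed function. -/
lemma elog1p_mul_split (K : ℕ) (hK : 1 ≤ K) (x y : ℝ≥0∞) :
    elog1p (x * y) ≤ K * elog1p y + (if (K : ℝ≥0∞) < x then elog1p x else 0) := by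
  split_ifs with h
  · refine (elog1p_mul x y).trans ?_
    rw [add_comm]
    gcongr
    exact le_mul_of_one_le_left zero_le (by exact_mod_cast hK)
  · rw [add_zero]
    refine le_trans (elog1p_mono ?_) (elog1p_nat_mul K y)
    gcongr
    exact not_lt.1 h

/-! ### The maximal radial function -/

lemma circlePt_norm (r θ : ℝ) : ‖circlePt r θ‖ = |r| := by
  simp [circlePt, Complex.norm_exp_ofReal_mul_I]

lemma circlePt_mem {r : ℝ} (hr : r ∈ Set.Ico (0 : ℝ) 1) (θ : ℝ) : circlePt r θ ∈ unitDisk := by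
  simp [unitDisk, circlePt_norm, abs_of_nonneg hr.1, hr.2]

lemma le_maxRad (f : ℂ → ℂ) {r : ℝ} (hr : r ∈ Set.Ico (0 : ℝ) 1) (θ : ℝ) :
    (‖f (circlePt r θ)‖₊ : ℝ≥0∞) ≤ maxRad f θ :=
  le_iSup₂ (f := fun r (_ : r ∈ Set.Ico (0 : ℝ) 1) => (‖f (circlePt r θ)‖₊ : ℝ≥0∞)) r hr

lemma maxRad_measurable {f : ℂ → ℂ} (hf : ContinuousOn f unitDisk) : Measurable (maxRad f) := by
  apply LowerSemicontinuous.measurable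
  apply lowerSemicontinuous_biSup
  intro r hr
  apply Continuous.lowerSemicontinuous
  have : Continuous fun θ => f (circlePt r θ) :=
    hf.comp_continuous (by unfold circlePt; fun_prop) (fun θ => circlePt_mem hr θ)
  exact ENNReal.continuous_coe.comp this.nnnorm

lemma maxRad_add (f g : ℂ → ℂ) (θ : ℝ) : maxRad (f + g) θ ≤ maxRad f θ + maxRad g θ := by
  refine iSup₂_le fun r hr => ?_
  refine le_trans ?_ (add_le_add (le_maxRad f hr θ) (le_maxRad g hr θ))
  rw [← ENNReal.coe_add]
  exact_mod_cast nnnorm_add_le _ _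

lemma maxRad_mul (f g : ℂ → ℂ) (θ : ℝ) : maxRad (f * g) θ ≤ maxRad f θ * maxRad g θ := by
  refine iSup₂_le fun r hr => ?_
  refine le_trans ?_ (mul_le_mul' (le_maxRad f hr θ) (le_maxRad g hr θ))
  rw [← ENNReal.coe_mul]
  exact_mod_cast nnnorm_mul_le _ _

lemma maxRad_sub_comm (f g : ℂ → ℂ) : maxRad (f - g) = maxRad (g - f) := by
  funext θ
  unfold maxRad
  simp only [Pi.sub_apply]
  refine iSup_congr fun r => iSup_congr fun _ => ?_
  rw [← nnnorm_neg, neg_sub]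

lemma maxRad_neg (f : ℂ → ℂ) : maxRad (-f) = maxRad f := by
  funext θ
  simp [maxRad]

lemma maxRad_const_le (c : ℂ) (θ : ℝ) : maxRad (fun _ => c) θ ≤ ‖c‖₊ :=
  iSup₂_le fun _ _ => le_rfl

/-! ### The functional -/

/-- Normalized Lebesgue measure on the circle. -/
def circMeas : Measure ℝ := (ENNReal.ofReal (2 * π))⁻¹ • volume.restrict (Set.Ioc 0 (2 * π))

lemma twoPi_ne : ENNReal.ofReal (2 * π) ≠ 0 := by simp [Real.pi_pos]

instance circMeas_prob : IsProbabilityMeasure circMeas := by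
  constructor
  simp only [circMeas, Measure.smul_apply, Measure.restrict_apply_univ, Real.volume_Ioc, sub_zero,
    smul_eq_mul]
  exact ENNReal.inv_mul_cancel twoPi_ne ENNReal.ofReal_ne_top

lemma circMeas_lintegral (φ : ℝ → ℝ≥0∞) :
    ∫⁻ θ, φ θ ∂circMeas = (∫⁻ θ in Set.Ioc 0 (2 * π), φ θ) / ENNReal.ofReal (2 * π) := by
  rw [circMeas, lintegral_smul_measure, smul_eq_mul, mul_comm, div_eq_mul_inv]

/-- The `L^p` functional. -/
def Nq (p : ℝ) (φ : ℝ → ℝ≥0∞) : ℝ≥0∞ := (∫⁻ θ, φ θ ^ p ∂circMeas) ^ (1 / p)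

/-- `log (1 + M f)`. -/
def Lf (f : ℂ → ℂ) (θ : ℝ) : ℝ≥0∞ := elog1p (maxRad f θ)

lemma rho_eq (p : ℝ) (f g : ℂ → ℂ) : rhoMetric p f g = Nq p (Lf (f - g)) := by
  rw [rhoMetric, Nq, circMeas_lintegral]; rfl

lemma Lf_measurable {f : ℂ → ℂ} (hf : DifferentiableOn ℂ f unitDisk) : Measurable (Lf f) :=
  elog1p_continuous.measurable.comp (maxRad_measurable hf.continuousOn)

section
variable {p : ℝ}

lemma Nq_mono (hp : 1 < p) {φ ψ : ℝ → ℝ≥0∞} (h : ∀ θ, φ θ ≤ ψ θ) : Nq p φ ≤ Nq p ψ := by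
  have : 0 ≤ p := by linarith
  unfold Nq
  refine ENNReal.rpow_le_rpow (lintegral_mono fun θ => ?_) (by positivity)
  exact ENNReal.rpow_le_rpow (h θ) this

lemma Nq_add (hp : 1 < p) {φ ψ : ℝ → ℝ≥0∞} (hφ : Measurable φ) (hψ : Measurable ψ) :
    Nq p (fun θ => φ θ + ψ θ) ≤ Nq p φ + Nq p ψ :=
  ENNReal.lintegral_Lp_add_le hφ.aemeasurable hψ.aemeasurable hp.le

lemma Nq_const (hp : 1 < p) (c : ℝ≥0∞) : Nq p (fun _ => c) = c := by
  have : p ≠ 0 := by linarith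
  simp [Nq, ← ENNReal.rpow_mul, this]

lemma Nq_const_mul (hp : 1 < p) (c : ℝ≥0∞) {φ : ℝ → ℝ≥0∞} (hφ : Measurable φ) :
    Nq p (fun θ => c * φ θ) = c * Nq p φ := by
  have h0 : 0 ≤ p := by linarith
  have h1 : p ≠ 0 := by linarith
  unfold Nq
  simp_rw [ENNReal.mul_rpow_of_nonneg _ _ h0]
  rw [lintegral_const_mul _ (hφ.pow_const p), ENNReal.mul_rpow_of_nonneg _ _ (by positivity),
    ← ENNReal.rpow_mul, mul_one_div_cancel h1, ENNReal.rpow_one]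

lemma Nq_lt_top (hp : 1 < p) {φ : ℝ → ℝ≥0∞} :
    Nq p φ < ∞ ↔ ∫⁻ θ, φ θ ^ p ∂circMeas < ∞ := by
  have : 0 < 1 / p := by positivity
  rw [Nq, lt_top_iff_ne_top, lt_top_iff_ne_top, ne_eq, ENNReal.rpow_eq_top_iff_of_pos this]

lemma lintegral_le_Nq (hp : 1 < p) {φ : ℝ → ℝ≥0∞} (hφ : Measurable φ) :
    ∫⁻ θ, φ θ ∂circMeas ≤ Nq p φ := by
  have := ENNReal.lintegral_mul_le_Lp_mul_Lq circMeas (Real.HolderConjugate.conjExponent hp)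
    (f := φ) (g := fun _ => 1) hφ.aemeasurable aemeasurable_const
  simpa [Nq] using this

lemma mem_iff (hp : 1 < p) (f : ℂ → ℂ) :
    f ∈ MpClass p ↔ DifferentiableOn ℂ f unitDisk ∧ Nq p (Lf f) < ∞ := by
  have key : (∫⁻ θ in Set.Ioc 0 (2 * π), elogPlus (maxRad f θ) ^ p) / ENNReal.ofReal (2 * π) < ∞ ↔
      Nq p (fun θ => elogPlus (maxRad f θ)) < ∞ := by
    rw [Nq_lt_top hp, circMeas_lintegral]
  unfold MpClass
  rw [Set.mem_ofPred_eq, key]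
  refine and_congr_right fun hf => ⟨fun h => ?_, fun h => ?_⟩
  · refine lt_of_le_of_lt (Nq_mono hp fun θ => elog1p_le_elogPlus (maxRad f θ)) ?_
    refine lt_of_le_of_lt (Nq_add hp measurable_const
      (elogPlus_measurable.comp (maxRad_measurable hf.continuousOn))) ?_
    rw [Nq_const hp]
    exact ENNReal.add_lt_top.2 ⟨ENNReal.ofReal_lt_top, h⟩
  · exact lt_of_le_of_lt (Nq_mono hp fun θ => elogPlus_le _) h

lemma Nq_Lf_add (hp : 1 < p) {f g : ℂ → ℂ} (hf : DifferentiableOn ℂ f unitDisk)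
    (hg : DifferentiableOn ℂ g unitDisk) : Nq p (Lf (f + g)) ≤ Nq p (Lf f) + Nq p (Lf g) :=
  (Nq_mono hp fun θ => (elog1p_mono (maxRad_add f g θ)).trans (elog1p_add _ _)).trans
    (Nq_add hp (Lf_measurable hf) (Lf_measurable hg))

lemma Nq_Lf_mul (hp : 1 < p) {f g : ℂ → ℂ} (hf : DifferentiableOn ℂ f unitDisk)
    (hg : DifferentiableOn ℂ g unitDisk) : Nq p (Lf (f * g)) ≤ Nq p (Lf f) + Nq p (Lf g) :=
  (Nq_mono hp fun θ => (elog1p_mono (maxRad_mul f g θ)).trans (elog1p_mul _ _)).trans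
    (Nq_add hp (Lf_measurable hf) (Lf_measurable hg))

lemma Nq_Lf_neg (f : ℂ → ℂ) : Nq p (Lf (-f)) = Nq p (Lf f) := by
  unfold Lf; rw [maxRad_neg]

lemma Nq_Lf_const_le (hp : 1 < p) (c : ℂ) : Nq p (Lf (fun _ => c)) ≤ elog1p ‖c‖₊ :=
  (Nq_mono hp fun θ => elog1p_mono (maxRad_const_le c θ)).trans (Nq_const hp _).le

lemma const_mem (hp : 1 < p) (c : ℂ) : (fun _ => c) ∈ MpClass p := by
  refine (mem_iff hp _).2 ⟨differentiableOn_const c, (Nq_Lf_const_le hp c).trans_lt ?_⟩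
  simp [elog1p]

lemma add_mem' (hp : 1 < p) {f g : ℂ → ℂ} (hf : f ∈ MpClass p) (hg : g ∈ MpClass p) :
    f + g ∈ MpClass p := by
  rw [mem_iff hp] at *
  exact ⟨hf.1.add hg.1, (Nq_Lf_add hp hf.1 hg.1).trans_lt (ENNReal.add_lt_top.2 ⟨hf.2, hg.2⟩)⟩

lemma neg_mem' (hp : 1 < p) {f : ℂ → ℂ} (hf : f ∈ MpClass p) : -f ∈ MpClass p := by
  rw [mem_iff hp] at *
  exact ⟨hf.1.neg, by rw [Nq_Lf_neg]; exact hf.2⟩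

lemma sub_mem' (hp : 1 < p) {f g : ℂ → ℂ} (hf : f ∈ MpClass p) (hg : g ∈ MpClass p) :
    f - g ∈ MpClass p := by
  rw [sub_eq_add_neg]
  exact add_mem' hp hf (neg_mem' hp hg)

lemma mul_mem' (hp : 1 < p) {f g : ℂ → ℂ} (hf : f ∈ MpClass p) (hg : g ∈ MpClass p) :
    f * g ∈ MpClass p := by
  rw [mem_iff hp] at *
  exact ⟨hf.1.mul hg.1, (Nq_Lf_mul hp hf.1 hg.1).trans_lt (ENNReal.add_lt_top.2 ⟨hf.2, hg.2⟩)⟩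

/-- Multiplication by a fixed element of `M^p` is continuous at zero. -/
lemma tendsto_mul_fixed (hp : 1 < p) {f : ℂ → ℂ} (hf : f ∈ MpClass p) {U : ℕ → ℂ → ℂ}
    (hU : ∀ n, U n ∈ MpClass p) (h : Tendsto (fun n => Nq p (Lf (U n))) atTop (𝓝 0)) :
    Tendsto (fun n => Nq p (Lf (f * U n))) atTop (𝓝 0) := by
  have hp0 : 0 < p := by linarith
  rw [mem_iff hp] at hf
  have hM := maxRad_measurable hf.1.continuousOn
  have hL := Lf_measurable hf.1
  let T : ℕ → ℝ → ℝ≥0∞ := fun K θ => if (K : ℝ≥0∞) < maxRad f θ then Lf f θ else 0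
  have hT : ∀ K, Measurable (T K) := fun K =>
    Measurable.ite (measurableSet_lt measurable_const hM) hL measurable_const
  have hfin : ∫⁻ θ, Lf f θ ^ p ∂circMeas ≠ ∞ := ((Nq_lt_top hp).1 hf.2).ne
  have htail : Tendsto (fun K => Nq p (T K)) atTop (𝓝 0) := by
    have h1 : Tendsto (fun K => ∫⁻ θ, T K θ ^ p ∂circMeas) atTop
        (𝓝 (∫⁻ _, 0 ∂circMeas)) := by
      refine tendsto_lintegral_of_dominated_convergence (fun θ => Lf f θ ^ p)
        (fun K => (hT K).pow_const p) (fun K => Eventually.of_forall fun θ => ?_) hfin ?_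
      · apply ENNReal.rpow_le_rpow _ hp0.le
        simp only [T]
        split_ifs <;> simp
      · filter_upwards [ae_lt_top (hL.pow_const p) hfin] with θ hθ
        have hfi : maxRad f θ ≠ ∞ := by
          intro h
          simp [Lf, h, hp0] at hθ
        obtain ⟨K0, hK0⟩ := ENNReal.exists_nat_gt hfi
        refine tendsto_const_nhds.congr' ?_
        filter_upwards [eventually_ge_atTop K0] with K hK
        have : ¬ ((K : ℝ≥0∞) < maxRad f θ) :=
          not_lt.2 (hK0.le.trans (by exact_mod_cast hK))
        simp [T, this, hp0]
    have h2 := (ENNReal.continuous_rpow_const (y := 1 / p)).tendsto _ |>.comp h1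
    have hz : (0 : ℝ≥0∞) ^ (1 / p) = 0 := ENNReal.zero_rpow_of_pos (by positivity)
    rw [lintegral_zero, hz] at h2
    exact h2
  have hbd : ∀ K : ℕ, 1 ≤ K → ∀ n, Nq p (Lf (f * U n)) ≤ K * Nq p (Lf (U n)) + Nq p (T K) := by
    intro K hK n
    have hm := Lf_measurable ((mem_iff hp _).1 (hU n)).1
    refine (Nq_mono hp fun θ => (elog1p_mono (maxRad_mul f (U n) θ)).trans
      (elog1p_mul_split K hK _ _)).trans ?_
    refine (Nq_add hp (hm.const_mul _) (hT K)).trans ?_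
    rw [← Nq_const_mul hp _ hm]
  rw [ENNReal.tendsto_nhds_zero]
  intro ε hε
  have hε2 : 0 < ε / 2 := ENNReal.half_pos hε.ne'
  obtain ⟨K, hK1, hK⟩ := ((eventually_ge_atTop 1).and
    (ENNReal.tendsto_nhds_zero.1 htail _ hε2)).exists
  have h3 : Tendsto (fun n => (K : ℝ≥0∞) * Nq p (Lf (U n))) atTop (𝓝 0) := by
    have := ENNReal.Tendsto.const_mul (a := (K : ℝ≥0∞)) h (Or.inr (by simp))
    simpa using this
  filter_upwards [ENNReal.tendsto_nhds_zero.1 h3 _ hε2] with n hn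
  calc _ ≤ _ := hbd K hK1 n
    _ ≤ ε / 2 + ε / 2 := add_le_add hn hK
    _ = ε := ENNReal.add_halves ε

lemma tendsto_mul' (hp : 1 < p) {F G : ℕ → ℂ → ℂ} {f g : ℂ → ℂ} (hF : ∀ n, F n ∈ MpClass p)
    (hG : ∀ n, G n ∈ MpClass p) (hf : f ∈ MpClass p) (hg : g ∈ MpClass p)
    (h1 : Tendsto (fun n => rhoMetric p (F n) f) atTop (nhds 0))
    (h2 : Tendsto (fun n => rhoMetric p (G n) g) atTop (nhds 0)) :
    Tendsto (fun n => rhoMetric p (F n * G n) (f * g)) atTop (nhds 0) := by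
  simp only [rho_eq] at *
  have hu := fun n => sub_mem' hp (hF n) hf
  have hv := fun n => sub_mem' hp (hG n) hg
  have t1 := tendsto_mul_fixed hp hf hv h2
  have t2 := tendsto_mul_fixed hp hg hu h1
  have t3 := ((h1.add h2).add t1).add t2
  simp only [add_zero] at t3
  refine tendsto_of_tendsto_of_tendsto_of_le_of_le tendsto_const_nhds t3 (fun _ => zero_le)
    fun n => ?_
  have e : F n * G n - f * g = (F n - f) * (G n - g) + f * (G n - g) + g * (F n - f) := by ring
  have d : ∀ {k : ℂ → ℂ}, k ∈ MpClass p → DifferentiableOn ℂ k unitDisk :=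
    fun hk => ((mem_iff hp _).1 hk).1
  have m1 := mul_mem' hp (hu n) (hv n)
  have m2 := mul_mem' hp hf (hv n)
  have m3 := mul_mem' hp hg (hu n)
  rw [e]
  refine (Nq_Lf_add hp (d (add_mem' hp m1 m2)) (d m3)).trans ?_
  gcongr
  refine (Nq_Lf_add hp (d m1) (d m2)).trans ?_
  gcongr
  exact Nq_Lf_mul hp (d (hu n)) (d (hv n))

end

/-! ### Sub-mean value property -/

lemma log_norm_le_circleAverage {g : ℂ → ℂ} {z : ℂ} {s : ℝ} (hs : 0 < s)
    (hg : AnalyticOnNhd ℂ g (Metric.closedBall z s)) (hz : g z ≠ 0) :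
    Real.log ‖g z‖ ≤ Real.circleAverage (fun w => Real.log ‖g w‖) z s := by
  have hs' : |s| = s := abs_of_pos hs
  rw [← hs'] at hg
  rw [hg.circleAverage_log_norm hs.ne' hz]
  have : 0 ≤ ∑ᶠ u, MeromorphicOn.divisor g (Metric.closedBall z |s|) u
      * Real.log (s * ‖z - u‖⁻¹) := by
    apply finsum_nonneg
    intro u
    by_cases hu : u ∈ Metric.closedBall z |s|
    · apply mul_nonneg (mod_cast MeromorphicOn.AnalyticOnNhd.divisor_nonneg hg ..)
      rcases eq_or_ne u z with rfl | h
      · simp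
      · apply Real.log_nonneg
        have h1 : 0 < ‖z - u‖ := norm_pos_iff.2 (sub_ne_zero.2 h.symm)
        rw [hs', Metric.mem_closedBall, dist_eq_norm, norm_sub_rev] at hu
        rw [← div_eq_mul_inv, one_le_div h1]
        exact hu
    · simp [hu]
  linarith

lemma submean {h : ℂ → ℂ} (hh : DifferentiableOn ℂ h unitDisk) {z : ℂ} {s : ℝ} (hs : 0 < s)
    (hsub : Metric.closedBall z s ⊆ unitDisk) :
    ENNReal.ofReal (2 * π) * elog1p ‖h z‖₊ ≤
      ∫⁻ θ in Set.Ioc 0 (2 * π), elog1p ‖h (z + circlePt s θ)‖₊ := by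
  obtain ⟨a, ha, haz⟩ : ∃ a : ℂ, ‖a‖ = 1 ∧ a * h z = ‖h z‖ := by
    rcases eq_or_ne (h z) 0 with h0 | h0
    · exact ⟨1, by simp, by simp [h0]⟩
    · have hn : (‖h z‖ : ℂ) ≠ 0 := by simpa using h0
      refine ⟨‖h z‖ / h z, ?_, ?_⟩
      · have : ‖h z‖ ≠ 0 := by simpa using h0
        simp [this]
      · field_simp
  have hopen : IsOpen unitDisk := Metric.isOpen_ball
  have hana : AnalyticOnNhd ℂ h unitDisk := hh.analyticOnNhd hopen
  let g : ℂ → ℂ := fun w => 1 + a * h w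
  have hg : AnalyticOnNhd ℂ g (Metric.closedBall z s) := fun w hw =>
    analyticAt_const.add (analyticAt_const.mul (hana w (hsub hw)))
  have hgz : ‖g z‖ = 1 + ‖h z‖ := by
    simp only [g, haz]
    rw [← Complex.ofReal_one, ← Complex.ofReal_add, Complex.norm_real, Real.norm_eq_abs,
      abs_of_nonneg (by positivity)]
  have hgz0 : g z ≠ 0 := by
    rw [← norm_pos_iff, hgz]; positivity
  have hmain := log_norm_le_circleAverage hs hg hgz0
  have hss : |s| = s := abs_of_pos hs
  have hcm : ∀ θ, circleMap z s θ ∈ unitDisk := fun θ =>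
    hsub (Metric.sphere_subset_closedBall (circleMap_mem_sphere z hs.le θ))
  have hcont : Continuous fun θ => Real.log (1 + ‖h (circleMap z s θ)‖) := by
    have : Continuous fun θ => h (circleMap z s θ) :=
      hh.continuousOn.comp_continuous (continuous_circleMap z s) hcm
    exact Continuous.log (continuous_const.add this.norm) fun θ => by positivity
  have hmono : Real.circleAverage (fun w => Real.log ‖g w‖) z s ≤
      Real.circleAverage (fun w => Real.log (1 + ‖h w‖)) z s := by
    apply Real.circleAverage_mono
    · apply MeromorphicOn.circleIntegrable_log_norm
      rw [hss]
      exact (hg.mono Metric.sphere_subset_closedBall).meromorphicOn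
    · exact hcont.intervalIntegrable _ _
    · intro w hw
      rcases eq_or_ne (g w) 0 with h0 | h0
      · simp only [h0, norm_zero, Real.log_zero]
        exact Real.log_nonneg (by simp)
      · apply Real.log_le_log (norm_pos_iff.2 h0)
        refine (norm_add_le _ _).trans ?_
        simp [ha]
  have hfin := hmain.trans hmono
  rw [hgz, Real.circleAverage, smul_eq_mul, intervalIntegral.integral_of_le Real.two_pi_pos.le,
    ← div_eq_inv_mul, le_div_iff₀ Real.two_pi_pos] at hfin
  have hL : ∀ w : ℂ, elog1p (‖h w‖₊) = ENNReal.ofReal (Real.log (1 + ‖h w‖)) := by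
    intro w
    rw [← elog1p_ofReal _ (norm_nonneg _), ofReal_norm, enorm_eq_nnnorm]
  simp only [hL]
  rw [mul_comm, ← ENNReal.ofReal_mul (Real.log_nonneg (by simp))]
  refine (ENNReal.ofReal_le_ofReal hfin).trans ?_
  rw [ofReal_integral_eq_lintegral_ofReal]
  · exact le_of_eq rfl
  · exact hcont.integrableOn_Ioc
  · exact Eventually.of_forall fun θ => Real.log_nonneg (by simp)

/-- Integration in polar coordinates over `(0, ∞) × (0, 2π]`. -/
lemma lintegral_polar {G : ℂ → ℝ≥0∞} (hG : Measurable G) :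
    ∫⁻ w, G w = ∫⁻ r in Set.Ioi (0 : ℝ), ENNReal.ofReal r *
      ∫⁻ θ in Set.Ioc 0 (2 * π), G (circlePt r θ) := by
  have hm : Measurable fun q : ℝ × ℝ => circlePt q.1 q.2 := by
    apply Continuous.measurable
    unfold circlePt
    fun_prop
  have e1 : ∀ q : ℝ × ℝ, -(Complex.polarCoord.symm q) = circlePt q.1 (q.2 + π) := by
    intro q
    rw [Complex.polarCoord_symm_apply, circlePt]
    push_cast
    rw [add_mul, Complex.exp_add, Complex.exp_pi_mul_I, Complex.exp_mul_I]
    ring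
  rw [← lintegral_neg_eq_self, ← Complex.lintegral_comp_polarCoord_symm]
  simp only [e1, smul_eq_mul]
  rw [polarCoord_target, Measure.volume_eq_prod, ← Measure.prod_restrict, lintegral_prod]
  · refine lintegral_congr fun r => ?_
    dsimp only
    rw [lintegral_const_mul]
    · congr 1
      rw [← restrict_Ioo_eq_restrict_Ioc]
      have := (measurePreserving_add_right volume π).setLIntegral_comp_preimage_emb
        (measurableEmbedding_addRight π) (fun θ => G (circlePt r θ)) (Set.Ioo 0 (2 * π))
      rw [← this]
      congr 2
      ext x
      simp only [Set.mem_Ioo, Set.mem_preimage]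
      constructor <;> rintro ⟨h1, h2⟩ <;> constructor <;> linarith
    · exact hG.comp (hm.comp (by fun_prop : Measurable fun θ : ℝ => (r, θ + π)))
  · apply Measurable.aemeasurable
    exact (ENNReal.measurable_ofReal.comp measurable_fst).mul
      (hG.comp (hm.comp (by fun_prop : Measurable fun q : ℝ × ℝ => (q.1, q.2 + π))))

lemma pointwise_bound {p : ℝ} (hp : 1 < p) {δ : ℝ} (hδ : 0 < δ) :
    ∃ C : ℝ≥0∞, C ≠ 0 ∧ C ≠ ∞ ∧ ∀ h : ℂ → ℂ, DifferentiableOn ℂ h unitDisk → ∀ z : ℂ,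
      Metric.ball z δ ⊆ unitDisk → C * elog1p ‖h z‖₊ ≤ Nq p (Lf h) := by
  let A : ℝ≥0∞ := ∫⁻ r in Set.Ioo 0 δ, ENNReal.ofReal r
  have hA : A ≠ ∞ := by
    have : A ≤ ENNReal.ofReal δ * ENNReal.ofReal δ := by
      calc A ≤ ∫⁻ r in Set.Ioo 0 δ, ENNReal.ofReal δ :=
            setLIntegral_mono measurable_const fun r hr => ENNReal.ofReal_le_ofReal hr.2.le
        _ = _ := by simp
    exact (this.trans_lt (ENNReal.mul_lt_top ENNReal.ofReal_lt_top ENNReal.ofReal_lt_top)).ne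
  have hA0 : A ≠ 0 := by
    have h1 : ENNReal.ofReal (δ / 2) * ENNReal.ofReal (δ / 2) ≤ A := by
      calc _ = ∫⁻ r in Set.Ioo (δ / 2) δ, ENNReal.ofReal (δ / 2) := by
            have : δ - δ / 2 = δ / 2 := by ring
            simp [this]
        _ ≤ ∫⁻ r in Set.Ioo (δ / 2) δ, ENNReal.ofReal r :=
            setLIntegral_mono (by fun_prop) fun r hr => ENNReal.ofReal_le_ofReal hr.1.le
        _ ≤ A := lintegral_mono_set (Set.Ioo_subset_Ioo_left (by linarith))
    have : 0 < ENNReal.ofReal (δ / 2) := ENNReal.ofReal_pos.2 (by linarith)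
    exact (lt_of_lt_of_le (ENNReal.mul_pos this.ne' this.ne') h1).ne'
  refine ⟨A, hA0, hA, fun h hh z hz => ?_⟩
  let G : ℂ → ℝ≥0∞ := unitDisk.indicator fun w => elog1p ‖h w‖₊
  have hopen : IsOpen unitDisk := Metric.isOpen_ball
  have hG : Measurable G := by
    classical
    have hc : ContinuousOn (fun w => elog1p (‖h w‖₊ : ℝ≥0∞)) unitDisk :=
      (elog1p_continuous.comp (ENNReal.continuous_coe.comp continuous_nnnorm)).comp_continuousOn
        hh.continuousOn
    have h1 := hc.measurable_piecewise (g := fun _ => 0) (continuousOn_const)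
      hopen.measurableSet
    have h2 : Measurable (unitDisk.piecewise (fun w => elog1p (‖h w‖₊ : ℝ≥0∞)) 0) := h1
    rwa [Set.piecewise_eq_indicator] at h2
  have hLm := Lf_measurable hh
  -- upper bound
  have up : ∫⁻ w, G w ≤ ∫⁻ θ in Set.Ioc 0 (2 * π), Lf h θ := by
    rw [lintegral_polar hG]
    calc _ ≤ ∫⁻ r in Set.Ioi (0 : ℝ), (Set.Ioo (0 : ℝ) 1).indicator
            (fun _ => ∫⁻ θ in Set.Ioc 0 (2 * π), Lf h θ) r := by
          refine setLIntegral_mono (measurable_const.indicator measurableSet_Ioo) fun r hr => ?_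
          have hr0 : 0 < r := hr
          by_cases h1 : r < 1
          · rw [Set.indicator_of_mem (show r ∈ Set.Ioo (0 : ℝ) 1 from ⟨hr, h1⟩)]
            calc _ ≤ 1 * ∫⁻ θ in Set.Ioc 0 (2 * π), Lf h θ := by
                  gcongr with θ
                  · exact ENNReal.ofReal_le_one.2 h1.le
                  · have hm : r ∈ Set.Ico (0 : ℝ) 1 := ⟨hr0.le, h1⟩
                    simp only [G]
                    rw [Set.indicator_of_mem (circlePt_mem hm θ)]
                    exact elog1p_mono (le_maxRad h hm θ)
              _ = _ := one_mul _
          · have : ∀ θ, G (circlePt r θ) = 0 := by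
              intro θ
              apply Set.indicator_of_notMem
              simpa [unitDisk, circlePt_norm, abs_of_pos hr0] using h1
            simp [this]
      _ ≤ ∫⁻ r, (Set.Ioo (0 : ℝ) 1).indicator
            (fun _ => ∫⁻ θ in Set.Ioc 0 (2 * π), Lf h θ) r := setLIntegral_le_lintegral _ _
      _ = _ := by
          rw [lintegral_indicator measurableSet_Ioo]
          simp
  -- lower bound
  have low : A * (ENNReal.ofReal (2 * π) * elog1p ‖h z‖₊) ≤ ∫⁻ w, G w := by
    have e := lintegral_add_left_eq_self (μ := (volume : Measure ℂ)) G z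
    rw [← e, lintegral_polar (G := fun x => G (z + x)) (hG.comp (measurable_const_add z))]
    calc _ = ∫⁻ r in Set.Ioo 0 δ, ENNReal.ofReal r * (ENNReal.ofReal (2 * π) * elog1p ‖h z‖₊) := by
          rw [lintegral_mul_const _ ENNReal.measurable_ofReal]
      _ ≤ ∫⁻ r in Set.Ioo 0 δ, ENNReal.ofReal r *
            ∫⁻ θ in Set.Ioc 0 (2 * π), G (z + circlePt r θ) := by
          refine setLIntegral_mono' measurableSet_Ioo fun r hr => ?_
          gcongr
          have hsub : Metric.closedBall z r ⊆ unitDisk :=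
            (Metric.closedBall_subset_ball hr.2).trans hz
          refine (submean hh hr.1 hsub).trans (le_of_eq ?_)
          refine lintegral_congr fun θ => ?_
          simp only [G]
          rw [Set.indicator_of_mem]
          apply hsub
          simp [circlePt_norm, abs_of_pos hr.1]
      _ ≤ _ := lintegral_mono_set Set.Ioo_subset_Ioi_self
  have hfin := (low.trans up)
  refine le_trans ?_ (lintegral_le_Nq hp hLm)
  rw [circMeas_lintegral, ENNReal.le_div_iff_mul_le (Or.inl twoPi_ne)
    (Or.inl ENNReal.ofReal_ne_top)]
  refine le_trans (le_of_eq ?_) hfin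
  ring

/-! ### Completeness -/

lemma maxRad_le_liminf {F : ℕ → ℂ → ℂ} {g f : ℂ → ℂ}
    (h : ∀ z ∈ unitDisk, Tendsto (fun m => F m z) atTop (𝓝 (f z))) (θ : ℝ) :
    maxRad (g - f) θ ≤ liminf (fun m => maxRad (g - F m) θ) atTop := by
  refine iSup₂_le fun r hr => ?_
  have h1 : Tendsto (fun m => (‖(g - F m) (circlePt r θ)‖₊ : ℝ≥0∞)) atTop
      (𝓝 (‖(g - f) (circlePt r θ)‖₊ : ℝ≥0∞)) := by
    refine ENNReal.tendsto_coe.2 (Tendsto.nnnorm ?_)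
    exact tendsto_const_nhds.sub (h _ (circlePt_mem hr θ))
  rw [← h1.liminf_eq]
  exact liminf_le_liminf (Eventually.of_forall fun m => le_maxRad _ hr θ)

lemma Nq_le_liminf {p : ℝ} (hp : 1 < p) {F : ℕ → ℂ → ℂ} {g f : ℂ → ℂ}
    (hF : ∀ n, DifferentiableOn ℂ (F n) unitDisk) (hg : DifferentiableOn ℂ g unitDisk)
    (h : ∀ z ∈ unitDisk, Tendsto (fun m => F m z) atTop (𝓝 (f z))) {ε : ℝ≥0∞} {N : ℕ}
    (hε : ∀ m ≥ N, Nq p (Lf (g - F m)) ≤ ε) : Nq p (Lf (g - f)) ≤ ε := by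
  have hp0 : 0 < p := by linarith
  let φ : ℝ≥0∞ → ℝ≥0∞ := fun x => elog1p x ^ p
  have hφc : Continuous φ := ENNReal.continuous_rpow_const.comp elog1p_continuous
  have hφm : Monotone φ := fun x y hxy => ENNReal.rpow_le_rpow (elog1p_mono hxy) hp0.le
  have key : ∀ ψ : ℝ → ℝ≥0∞, Nq p ψ ≤ ε ↔ ∫⁻ θ, ψ θ ^ p ∂circMeas ≤ ε ^ p := by
    intro ψ
    rw [Nq, one_div, ENNReal.rpow_inv_le_iff hp0]
  rw [key]
  calc ∫⁻ θ, Lf (g - f) θ ^ p ∂circMeas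
      ≤ ∫⁻ θ, liminf (fun m => φ (maxRad (g - F m) θ)) atTop ∂circMeas := by
        refine lintegral_mono fun θ => ?_
        refine (hφm (maxRad_le_liminf h θ)).trans (le_of_eq ?_)
        exact hφm.map_liminf_of_continuousAt _ hφc.continuousAt
    _ ≤ liminf (fun m => ∫⁻ θ, φ (maxRad (g - F m) θ) ∂circMeas) atTop := by
        refine lintegral_liminf_le fun m => ?_
        exact hφc.measurable.comp (maxRad_measurable (hg.sub (hF m)).continuousOn)
    _ ≤ ε ^ p := by
        refine liminf_le_of_frequently_le' (Eventually.frequently ?_)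
        filter_upwards [eventually_ge_atTop N] with m hm
        exact (key _).1 (hε m hm)

lemma complete' {p : ℝ} (hp : 1 < p) (F : ℕ → ℂ → ℂ) (hF : ∀ n, F n ∈ MpClass p)
    (hC : ∀ ε : ℝ≥0∞, 0 < ε → ∃ N, ∀ m ≥ N, ∀ n ≥ N, rhoMetric p (F m) (F n) < ε) :
    ∃ f ∈ MpClass p, Tendsto (fun n => rhoMetric p (F n) f) atTop (nhds 0) := by
  have hd : ∀ n, DifferentiableOn ℂ (F n) unitDisk := fun n => ((mem_iff hp _).1 (hF n)).1
  have hopen : IsOpen unitDisk := Metric.isOpen_ball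
  -- uniformly Cauchy on smaller disks
  have huc : ∀ δ : ℝ, 0 < δ →
      UniformCauchySeqOn F atTop {z | Metric.ball z δ ⊆ unitDisk} := by
    intro δ hδ
    obtain ⟨C, hC0, hCt, hb⟩ := pointwise_bound hp hδ
    rw [Metric.uniformCauchySeqOn_iff]
    intro ε hε
    have hη : 0 < C * elog1p (ENNReal.ofReal ε) :=
      ENNReal.mul_pos hC0 (elog1p_pos (ENNReal.ofReal_pos.2 hε)).ne'
    obtain ⟨N, hN⟩ := hC _ hη
    refine ⟨N, fun m hm n hn z hz => ?_⟩
    have h1 := (hb (F m - F n) ((hd m).sub (hd n)) z hz).trans_lt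
      (by rw [← rho_eq]; exact hN m hm n hn)
    by_contra hcon
    rw [not_lt, dist_eq_norm] at hcon
    refine absurd h1 (not_lt.2 ?_)
    gcongr
    apply elog1p_mono
    rw [← enorm_eq_nnnorm, ← ofReal_norm]
    exact ENNReal.ofReal_le_ofReal hcon
  have hball : ∀ z ∈ unitDisk, ∃ δ > 0, Metric.ball z δ ⊆ unitDisk := fun z hz =>
    Metric.isOpen_iff.1 hopen z hz
  have hlim : ∀ z, ∃ w, z ∈ unitDisk → Tendsto (fun m => F m z) atTop (𝓝 w) := by
    intro z
    by_cases hz : z ∈ unitDisk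
    · obtain ⟨δ, hδ, hs⟩ := hball z hz
      obtain ⟨w, hw⟩ := cauchySeq_tendsto_of_complete ((huc δ hδ).cauchySeq hs)
      exact ⟨w, fun _ => hw⟩
    · exact ⟨0, fun h => absurd h hz⟩
  choose f hf using hlim
  have hlu : TendstoLocallyUniformlyOn F f atTop unitDisk := by
    rw [tendstoLocallyUniformlyOn_iff_forall_isCompact hopen]
    intro K hK hKc
    obtain ⟨δ, hδ, hs⟩ := hKc.exists_thickening_subset_open hopen hK
    refine ((huc δ hδ).tendstoUniformlyOn_of_tendsto (f := f) ?_).mono ?_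
    · intro z hz
      exact hf z (hz (Metric.mem_ball_self hδ))
    · intro z hz
      exact (Metric.ball_subset_thickening hz δ).trans hs
  have hfd : DifferentiableOn ℂ f unitDisk :=
    hlu.differentiableOn (Eventually.of_forall hd) hopen
  have hconv : ∀ ε : ℝ≥0∞, 0 < ε → ∃ N, ∀ n ≥ N, Nq p (Lf (F n - f)) ≤ ε := by
    intro ε hε
    obtain ⟨N, hN⟩ := hC ε hε
    refine ⟨N, fun n hn => Nq_le_liminf hp hd (hd n) hf (N := N) fun m hm => ?_⟩
    rw [← rho_eq]
    exact (hN n hn m hm).le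
  refine ⟨f, ?_, ?_⟩
  · obtain ⟨N, hN⟩ := hconv 1 one_pos
    have h1 : F N - f ∈ MpClass p :=
      (mem_iff hp _).2 ⟨(hd N).sub hfd, (hN N le_rfl).trans_lt ENNReal.one_lt_top⟩
    have := sub_mem' hp (hF N) h1
    simpa using this
  · simp only [rho_eq]
    rw [ENNReal.tendsto_atTop_zero]
    exact hconv

lemma rho_eq_zero_iff {p : ℝ} (hp : 1 < p) {f g : ℂ → ℂ} (hf : f ∈ MpClass p)
    (hg : g ∈ MpClass p) : rhoMetric p f g = 0 ↔ Set.EqOn f g unitDisk := by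
  have hp0 : 0 < p := by linarith
  have hd := ((mem_iff hp _).1 (sub_mem' hp hf hg)).1
  have hopen : IsOpen unitDisk := Metric.isOpen_ball
  rw [rho_eq]
  constructor
  · intro h
    have h1 := (lintegral_le_Nq hp (Lf_measurable hd)).trans h.le
    rw [nonpos_iff_eq_zero, lintegral_eq_zero_iff (Lf_measurable hd)] at h1
    obtain ⟨θ, hθ⟩ := h1.exists
    have hM : maxRad (f - g) θ = 0 := elog1p_eq_zero hθ
    have hz : ∀ r ∈ Set.Ico (0 : ℝ) 1, (f - g) (circlePt r θ) = 0 := by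
      intro r hr
      have := (le_maxRad (f - g) hr θ).trans hM.le
      simpa using this
    have hfr : ∃ᶠ z in 𝓝[≠] (0 : ℂ), (f - g) z = 0 := by
      have ht : Tendsto (fun r : ℝ => circlePt r θ) (𝓝[>] 0) (𝓝[≠] 0) := by
        refine tendsto_nhdsWithin_iff.2 ⟨?_, ?_⟩
        · have hc : Continuous fun r : ℝ => circlePt r θ := by unfold circlePt; fun_prop
          have := hc.tendsto 0
          simp only [circlePt, Complex.ofReal_zero, zero_mul] at this
          exact this.mono_left nhdsWithin_le_nhds
        · filter_upwards [self_mem_nhdsWithin] with r hr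
          have hr : 0 < r := hr
          simp [circlePt, hr.ne']
      refine ht.frequently (Eventually.frequently ?_)
      filter_upwards [Ioo_mem_nhdsGT (zero_lt_one' ℝ)] with r hr
      exact hz r ⟨hr.1.le, hr.2⟩
    have := (hd.analyticOnNhd hopen).eqOn_zero_of_preconnected_of_frequently_eq_zero
      (convex_ball (0 : ℂ) 1).isPreconnected (z₀ := 0) (by simp [unitDisk]) hfr
    intro z hz'
    exact sub_eq_zero.1 (this hz')
  · intro h
    have hM : ∀ θ, Lf (f - g) θ = 0 := by
      intro θ
      have : maxRad (f - g) θ = 0 := by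
        refine le_antisymm (iSup₂_le fun r hr => ?_) zero_le
        simp [h (circlePt_mem hr θ)]
      simp [Lf, this]
    have : Lf (f - g) = fun _ => 0 := funext hM
    rw [this, Nq_const hp]

/-- For `p > 1`, the class `M^p` with the metric `ρ_p` is an `F`-algebra:
`ρ_p` is a (finite-valued) metric on `M^p`, `M^p` is a complex algebra, the metric space is
complete, and addition, scalar multiplication and multiplication are (sequentially)
continuous. -/
theorem Mp_is_F_algebra (p : ℝ) (hp : 1 < p) :
    (∀ f ∈ MpClass p, ∀ g ∈ MpClass p, rhoMetric p f g ≠ ∞) ∧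
    (∀ f ∈ MpClass p, ∀ g ∈ MpClass p, (rhoMetric p f g = 0 ↔ Set.EqOn f g unitDisk)) ∧
    (∀ f ∈ MpClass p, ∀ g ∈ MpClass p, rhoMetric p f g = rhoMetric p g f) ∧
    (∀ f ∈ MpClass p, ∀ g ∈ MpClass p, ∀ h ∈ MpClass p,
      rhoMetric p f h ≤ rhoMetric p f g + rhoMetric p g h) ∧
    (∀ f ∈ MpClass p, ∀ g ∈ MpClass p, f + g ∈ MpClass p) ∧
    (∀ c : ℂ, ∀ f ∈ MpClass p, c • f ∈ MpClass p) ∧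
    (∀ f ∈ MpClass p, ∀ g ∈ MpClass p, f * g ∈ MpClass p) ∧
    -- completeness
    (∀ F : ℕ → ℂ → ℂ, (∀ n, F n ∈ MpClass p) →
      (∀ ε : ℝ≥0∞, 0 < ε → ∃ N, ∀ m ≥ N, ∀ n ≥ N, rhoMetric p (F m) (F n) < ε) →
      ∃ f ∈ MpClass p, Tendsto (fun n => rhoMetric p (F n) f) atTop (nhds 0)) ∧
    -- continuity of addition
    (∀ F G : ℕ → ℂ → ℂ, ∀ f g : ℂ → ℂ, (∀ n, F n ∈ MpClass p) → (∀ n, G n ∈ MpClass p) →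
      f ∈ MpClass p → g ∈ MpClass p →
      Tendsto (fun n => rhoMetric p (F n) f) atTop (nhds 0) →
      Tendsto (fun n => rhoMetric p (G n) g) atTop (nhds 0) →
      Tendsto (fun n => rhoMetric p (F n + G n) (f + g)) atTop (nhds 0)) ∧
    -- continuity of scalar multiplication
    (∀ c : ℕ → ℂ, ∀ c₀ : ℂ, ∀ F : ℕ → ℂ → ℂ, ∀ f : ℂ → ℂ,
      (∀ n, F n ∈ MpClass p) → f ∈ MpClass p →
      Tendsto c atTop (nhds c₀) →
      Tendsto (fun n => rhoMetric p (F n) f) atTop (nhds 0) →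
      Tendsto (fun n => rhoMetric p (c n • F n) (c₀ • f)) atTop (nhds 0)) ∧
    -- joint continuity of multiplication
    (∀ F G : ℕ → ℂ → ℂ, ∀ f g : ℂ → ℂ, (∀ n, F n ∈ MpClass p) → (∀ n, G n ∈ MpClass p) →
      f ∈ MpClass p → g ∈ MpClass p →
      Tendsto (fun n => rhoMetric p (F n) f) atTop (nhds 0) →
      Tendsto (fun n => rhoMetric p (G n) g) atTop (nhds 0) →
      Tendsto (fun n => rhoMetric p (F n * G n) (f * g)) atTop (nhds 0)) := by
  have hd : ∀ {k : ℂ → ℂ}, k ∈ MpClass p → DifferentiableOn ℂ k unitDisk :=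
    fun hk => ((mem_iff hp _).1 hk).1
  have hsm : ∀ (c : ℂ) (f : ℂ → ℂ), c • f = (fun _ => c) * f := fun c f => rfl
  refine ⟨?_, ?_, ?_, ?_, ?_, ?_, ?_, ?_, ?_, ?_, ?_⟩
  · intro f hf g hg
    rw [rho_eq]
    exact ((mem_iff hp _).1 (sub_mem' hp hf hg)).2.ne
  · intro f hf g hg
    exact rho_eq_zero_iff hp hf hg
  · intro f _ g _
    rw [rho_eq, rho_eq]
    unfold Lf
    rw [maxRad_sub_comm]
  · intro f hf g hg h hh
    simp only [rho_eq]
    have e : f - h = (f - g) + (g - h) := by ring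
    rw [e]
    exact Nq_Lf_add hp (hd (sub_mem' hp hf hg)) (hd (sub_mem' hp hg hh))
  · exact fun f hf g hg => add_mem' hp hf hg
  · intro c f hf
    rw [hsm]
    exact mul_mem' hp (const_mem hp c) hf
  · exact fun f hf g hg => mul_mem' hp hf hg
  · exact complete' hp
  · intro F G f g hF hG hf hg h1 h2
    have t := h1.add h2
    rw [add_zero] at t
    refine tendsto_of_tendsto_of_tendsto_of_le_of_le tendsto_const_nhds t (fun _ => zero_le)
      fun n => ?_
    simp only [rho_eq]
    have e : F n + G n - (f + g) = (F n - f) + (G n - g) := by ring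
    rw [e]
    exact Nq_Lf_add hp (hd (sub_mem' hp (hF n) hf)) (hd (sub_mem' hp (hG n) hg))
  · intro c c₀ F f hF hf hc h
    simp only [hsm]
    refine tendsto_mul' hp (fun n => const_mem hp (c n)) hF (const_mem hp c₀) hf ?_ h
    have h1 : Tendsto (fun n => elog1p (‖c n - c₀‖₊ : ℝ≥0∞)) atTop (𝓝 0) := by
      have h2 : Tendsto (fun n => (‖c n - c₀‖₊ : ℝ≥0∞)) atTop (𝓝 0) := by
        have h3 : Tendsto (fun n => ‖c n - c₀‖₊) atTop (𝓝 ‖c₀ - c₀‖₊) :=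
          (hc.sub tendsto_const_nhds).nnnorm
        rw [sub_self, nnnorm_zero] at h3
        have h5 := ENNReal.tendsto_coe.2 h3
        rwa [ENNReal.coe_zero] at h5
      have h4 := (elog1p_continuous.tendsto 0).comp h2
      rw [elog1p_zero] at h4
      exact h4
    refine tendsto_of_tendsto_of_tendsto_of_le_of_le tendsto_const_nhds h1 (fun _ => zero_le)
      fun n => ?_
    simp only [rho_eq]
    exact Nq_Lf_const_le hp (c n - c₀)
  · intro F G f g hF hG hf hg h1 h2
    exact tendsto_mul' hp hF hG hf hg h1 h2
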